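/- Let V be a finite-dimensional real vector space and let P = conv(Q₁) and Q = conv(Q₂) be nonempty polytopes in V (Q₁, Q₂ finite and nonempty). For every vertex v of P there exists a (not necessarily unique) vertex w of Q such that v + w is a vertex of the Minkowski sum P + Q. -/

import Mathlib

open Pointwise

/-- The statement in a locally convex Hausdorff topological vector space. -/
theorem stmt_14_aux {V : Type*} [AddCommGroup V] [Module ℝ V] [TopologicalSpace V]
    [IsTopologicalAddGroup V] [ContinuousSMul ℝ V] [LocallyConvexSpace ℝ V] [T2Space V]
    (Q₁ Q₂ : Finset V) (h₂ : Q₂.Nonempty) (v : V)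
    (hv : v ∈ Set.extremePoints ℝ (convexHull ℝ (Q₁ : Set V))) :
    ∃ w ∈ Set.extremePoints ℝ (convexHull ℝ (Q₂ : Set V)),
      v + w ∈ Set.extremePoints ℝ
        (convexHull ℝ (Q₁ : Set V) + convexHull ℝ (Q₂ : Set V)) := by
  have hconv := ((convex_convexHull ℝ (Q₁ : Set V)).mem_extremePoints_iff_convex_diff.1 hv).2
  have hsub : convexHull ℝ ((Q₁ : Set V) \ {v}) ⊆ convexHull ℝ (Q₁ : Set V) \ {v} :=
    convexHull_min (Set.diff_subset_diff_left (subset_convexHull ℝ _)) hconv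
  have hnot : v ∉ convexHull ℝ ((Q₁ : Set V) \ {v}) := fun h => (hsub h).2 rfl
  have hfin : ((Q₁ : Set V) \ {v}).Finite := Q₁.finite_toSet.diff
  obtain ⟨f, u, hfu, huv⟩ := geometric_hahn_banach_closed_point (convex_convexHull ℝ _)
    (hfin.isCompact_convexHull (𝕜 := ℝ)).isClosed hnot
  have hS : Convex ℝ {p : V | p = v ∨ f p < f v} := by
    rw [convex_iff_openSegment_subset]
    rintro x hx y hy z ⟨a, b, ha, hb, hab, rfl⟩
    have key : ∀ t : V, (t = v ∨ f t < f v) → f t ≤ f v := by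
      rintro t (rfl | h)
      · exact le_rfl
      · exact h.le
    have hx' := key x hx
    have hy' := key y hy
    simp only [Set.mem_setOf_eq, map_add, map_smul, smul_eq_mul] at hx hy ⊢
    have hb' : b = 1 - a := by linarith
    subst hb'
    rcases hx with rfl | hx
    · rcases hy with rfl | hy
      · left
        rw [← add_smul, hab, one_smul]
      · right
        nlinarith
    · right
      nlinarith
  have hP : ∀ p ∈ convexHull ℝ (Q₁ : Set V), p = v ∨ f p < f v := by
    refine fun p hp => convexHull_min (t := {p : V | p = v ∨ f p < f v}) ?_ hS hp
    intro q hq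
    by_cases hqv : q = v
    · exact Or.inl hqv
    · exact Or.inr ((hfu q (subset_convexHull ℝ _ ⟨hq, hqv⟩)).trans huv)
  have hP' : ∀ p ∈ convexHull ℝ (Q₁ : Set V), f p ≤ f v := by
    intro p hp
    rcases hP p hp with rfl | h
    · exact le_rfl
    · exact h.le
  have hQc : IsCompact (convexHull ℝ (Q₂ : Set V)) := Q₂.finite_toSet.isCompact_convexHull (𝕜 := ℝ)
  have hQn : (convexHull ℝ (Q₂ : Set V)).Nonempty := by
    simpa using h₂
  have hexp : IsExposed ℝ (convexHull ℝ (Q₂ : Set V)) (f.toExposed (convexHull ℝ (Q₂ : Set V))) :=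
    ContinuousLinearMap.toExposed.isExposed
  have hne : (f.toExposed (convexHull ℝ (Q₂ : Set V))).Nonempty := by
    obtain ⟨x, hx, hmax⟩ := hQc.exists_isMaxOn hQn f.continuous.continuousOn
    exact ⟨x, hx, fun y hy => hmax hy⟩
  obtain ⟨w, hw⟩ := (hexp.isCompact hQc).extremePoints_nonempty hne
  have hwQ := hexp.isExtreme.extremePoints_subset_extremePoints hw
  refine ⟨w, hwQ, Set.add_mem_add hv.1 hwQ.1, ?_⟩
  have hwmax : ∀ y ∈ convexHull ℝ (Q₂ : Set V), f y ≤ f w := hw.1.2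
  rintro _ ⟨p₁, hp₁, q₁, hq₁, rfl⟩ _ ⟨p₂, hp₂, q₂, hq₂, rfl⟩ ⟨a, b, ha, hb, hab, he⟩
  have hfe := congrArg f he
  simp only [map_add, map_smul, smul_eq_mul] at hfe
  have e1 := hP' p₁ hp₁
  have e2 := hP' p₂ hp₂
  have e3 := hwmax q₁ hq₁
  have e4 := hwmax q₂ hq₂
  have hb' : b = 1 - a := by linarith
  have k1 : p₁ = v := by
    rcases hP p₁ hp₁ with h | h
    · exact h
    · subst hb'
      nlinarith
  have k2 : p₂ = v := by
    rcases hP p₂ hp₂ with h | h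
    · exact h
    · subst hb'
      nlinarith
  subst k1
  subst k2
  have hw' : a • q₁ + b • q₂ = w := by
    have : a • (p₂ + q₁) + b • (p₂ + q₂) = (a + b) • p₂ + (a • q₁ + b • q₂) := by module
    rw [this, hab, one_smul] at he
    exact add_left_cancel he
  have := hwQ.2 hq₁ hq₂ ⟨a, b, ha, hb, hab, hw'⟩
  simp [this]

/-- For every vertex `v` of a nonempty polytope `P = conv(Q₁)` in a finite-dimensional
real vector space there is a (not necessarily unique) vertex `w` of a nonempty polytope
`Q = conv(Q₂)` such that `v + w` is a vertex of the Minkowski sum `P + Q`. -/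
theorem stmt_14 {V : Type*} [AddCommGroup V] [Module ℝ V] [FiniteDimensional ℝ V]
    (Q₁ Q₂ : Finset V) (h₁ : Q₁.Nonempty) (h₂ : Q₂.Nonempty) (v : V)
    (hv : v ∈ Set.extremePoints ℝ (convexHull ℝ (Q₁ : Set V))) :
    ∃ w ∈ Set.extremePoints ℝ (convexHull ℝ (Q₂ : Set V)),
      v + w ∈ Set.extremePoints ℝ
        (convexHull ℝ (Q₁ : Set V) + convexHull ℝ (Q₂ : Set V)) := by
  let e := (Module.finBasis ℝ V).equivFun
  letI : TopologicalSpace V := TopologicalSpace.induced e inferInstance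
  haveI : IsTopologicalAddGroup V := topologicalAddGroup_induced e
  haveI : ContinuousSMul ℝ V := continuousSMul_induced e
  haveI : LocallyConvexSpace ℝ V := LocallyConvexSpace.induced e.toLinearMap
  haveI : T2Space V := T2Space.of_injective_continuous e.injective continuous_induced_dom
  exact stmt_14_aux Q₁ Q₂ h₂ v hv
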